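/- Let A ⊊ G_n be non-empty and x ∈ G_n. Then P^{G_n}-almost surely, E^{G_n}[ Ψ_{G_n}(x) | σ(Ψ_{G_n}(y), y ∈ A) ] = E_x^{G_n}[ Ψ_{G_n}(X_{H_A}) ] − (E_x^{G_n}[H_A] / E_π^{G_n}[H_A]) · E_π^{G_n}[ Ψ_{G_n}(X_{H_A}) ], where E_π^{G_n} is the expectation for simple random walk on G_n started from the uniform distribution on the vertices of G_n. -/

import Mathlib

open MeasureTheory ProbabilityTheory Filter Set
open scoped ENNReal NNReal ENat Classical

namespace GFF

variable {V : Type*} {T : Type*}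

/-- Number of ordered adjacent pairs inside `U` (twice the number of edges of the induced
subgraph). -/
noncomputable def adjPairs (G : SimpleGraph V) (U : Set V) : ℕ :=
  Set.ncard {p : V × V | p.1 ∈ U ∧ p.2 ∈ U ∧ G.Adj p.1 p.2}

/-- `U` (assumed connected) induces a tree, i.e. has tree excess zero. -/
def TxZero (G : SimpleGraph V) (U : Set V) : Prop :=
  adjPairs G U = 2 * (Set.ncard U - 1)

/-- Closed ball of radius `R` for the graph distance. -/
def gball (G : SimpleGraph V) (x : V) (R : ℕ) : Set V := {y | G.dist x y ≤ R}

/-- Set of vertices within distance `R` of the set `A`. -/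
def sball (G : SimpleGraph V) (A : Set V) (R : ℕ) : Set V := {y | ∃ a ∈ A, G.dist a y ≤ R}

/-- Connected component containing `x` of the level set `{ω ≥ h}`. -/
def levelComp (G : SimpleGraph V) (h : ℝ) (ω : V → ℝ) (x : V) : Set V :=
  {y | ∃ p : G.Walk x y, ∀ v ∈ p.support, h ≤ ω v}

/-- `G` is `d`-regular. -/
def IsReg (G : SimpleGraph V) (d : ℕ) : Prop := ∀ v, Nat.card (G.neighborSet v) = d

/-- `G` is an infinite `d`-regular tree. -/
def IsRegTree (G : SimpleGraph V) (d : ℕ) : Prop :=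
  G.Connected ∧ G.IsAcyclic ∧ IsReg G d

/-- Transition matrix of SRW on a `d`-regular graph. -/
noncomputable def transP [Fintype V] (G : SimpleGraph V) (d : ℕ) : Matrix V V ℝ :=
  Matrix.of fun u v => if G.Adj u v then ((d : ℝ))⁻¹ else 0

/-- All non-zero eigenvalues of `I - P` are at least `β`. -/
def SpectralGapLB [Fintype V] (G : SimpleGraph V) (d : ℕ) (β : ℝ) : Prop :=
  ∀ (f : V → ℝ) (lam : ℝ),
    Matrix.mulVec ((1 : Matrix V V ℝ) - transP G d) f = lam • f → f ≠ 0 → lam = 0 ∨ β ≤ lam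

/-- `P_x[X̄_t = y]` for the continuous-time SRW with i.i.d. mean-one exponential holding
times (Poissonized jump chain). -/
noncomputable def heatK [Fintype V] (G : SimpleGraph V) (d : ℕ) (t : ℝ) (x y : V) : ℝ :=
  ∑' k : ℕ, Real.exp (-t) * t ^ k / (Nat.factorial k) * ((transP G d) ^ k) x y

/-- The zero-average Green function. -/
noncomputable def zGreen [Fintype V] (G : SimpleGraph V) (d Nn : ℕ) (x y : V) : ℝ :=
  ∫ t in Set.Ioi (0 : ℝ), (heatK G d t x y - 1 / (Nn : ℝ))

/-- Green function of SRW on the `d`-regular tree. -/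
noncomputable def treeGreen (G : SimpleGraph V) (d : ℕ) (x y : V) : ℝ :=
  (((d : ℝ) - 1) / ((d : ℝ) - 2)) * (((d : ℝ) - 1)⁻¹) ^ (G.dist x y)

/-- `μ` is the law of the centred Gaussian field with covariance `K`. -/
def IsGaussianField {I : Type*} (μ : Measure (I → ℝ)) (K : I → I → ℝ) : Prop :=
  IsProbabilityMeasure μ ∧
    ∀ c : I →₀ ℝ,
      μ.map (fun ω => ∑ i ∈ c.support, c i * ω i) =
        gaussianReal 0 (Real.toNNReal (∑ i ∈ c.support, ∑ j ∈ c.support, c i * c j * K i j))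

/-- One-step transition probability of SRW. -/
noncomputable def srwStep (G : SimpleGraph V) (d : ℕ) (u v : V) : ℝ≥0∞ :=
  if G.Adj u v then (d : ℝ≥0∞)⁻¹ else 0

/-- `W x` is the law of discrete-time SRW on `G` started at `x`. -/
def IsSRW [MeasurableSpace V] (G : SimpleGraph V) (d : ℕ) (W : V → Measure (ℕ → V)) : Prop :=
  (∀ x, IsProbabilityMeasure (W x)) ∧
    ∀ (x : V) (k : ℕ) (p : ℕ → V),
      W x {ω | ∀ i ≤ k, ω i = p i} =
        (if p 0 = x then 1 else 0) * ∏ i ∈ Finset.range k, srwStep G d (p i) (p (i + 1))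

/-- Entrance time of the set `A` (`⊤` if never entered). -/
noncomputable def hitTime (A : Set V) (ω : ℕ → V) : ℕ∞ :=
  sInf ((Nat.cast : ℕ → ℕ∞) '' {k | ω k ∈ A})

/-- Exit time of the set `U`. -/
noncomputable def exitTime (U : Set V) (ω : ℕ → V) : ℕ∞ := hitTime Uᶜ ω

/-- Position of the walk at the entrance time of `A`. -/
noncomputable def stopAt (A : Set V) (ω : ℕ → V) : V := ω (hitTime A ω).toNat

/-- `π` is a cover tree of `G` at `x`. -/
def IsCoverMap (Gt : SimpleGraph T) (G : SimpleGraph V) (o : T) (x : V) (π : T → V) : Prop :=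
  π o = x ∧ Function.Surjective π ∧ ∀ y : T, π '' (Gt.neighborSet y) = G.neighborSet (π y)

/-- `T_d^+`: the vertices of the tree whose geodesic to `o` avoids the fixed neighbour
`obar` of `o`. -/
def treePlus (Gt : SimpleGraph T) (o obar : T) : Set T :=
  {z | Gt.dist z obar = Gt.dist z o + 1}

/-- `S^+_{T_d}(o,R)`. -/
def spherePlus (Gt : SimpleGraph T) (o obar : T) (R : ℕ) : Set T :=
  {z | z ∈ treePlus Gt o obar ∧ Gt.dist o z = R}

/-- The critical value for level-set percolation on the tree (w.r.t. the law `μT`). -/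
noncomputable def hstar (Gt : SimpleGraph T) (o : T) (μT : Measure (T → ℝ)) : ℝ :=
  sInf {h : ℝ | μT {ω | (levelComp Gt h ω o).Infinite} = 0}

/-- The forward percolation probability `η⁺(h)`. -/
noncomputable def etaPlus (Gt : SimpleGraph T) (o obar : T) (μT : Measure (T → ℝ)) (h : ℝ) :
    ℝ :=
  (μT {ω | (levelComp Gt h ω o ∩ treePlus Gt o obar).Infinite}).toReal

/-- `s_n`. -/
noncomputable def sn (d Nn : ℕ) : ℕ :=
  max 1 ⌊(8 : ℝ) * Real.logb ((d : ℝ) - 1) (Real.logb ((d : ℝ) - 1) (Nn : ℝ))⌋₊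

/-- `c₀ = αβ/(d-1)`. -/
noncomputable def c0 (d : ℕ) (α β : ℝ) : ℝ := α * β / ((d : ℝ) - 1)

/-- `r_n`. -/
noncomputable def rn (d : ℕ) (α β : ℝ) (Nn : ℕ) : ℕ :=
  max 1 ⌊(c0 d α β / 18) * Real.logb ((d : ℝ) - 1) (Nn : ℝ)⌋₊

/-- `R_n`. -/
noncomputable def Rn (d : ℕ) (α β : ℝ) (Nn : ℕ) : ℕ :=
  max 1 ⌊(c0 d α β / 6) * Real.logb ((d : ℝ) - 1) (Nn : ℝ)⌋₊

/-- `F_A(x,s)`: the vertices of `B(A,s) ∖ A` connected to `x` within `B(A,s) ∖ A`. -/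
def Fset (G : SimpleGraph V) (A : Set V) (s : ℕ) (x : V) : Set V :=
  {z | ∃ p : G.Walk x z, ∀ v ∈ p.support, v ∈ sball G A s ∧ v ∉ A}

/-- Good vertex at the boundary of `A`. -/
def GoodVertex (G : SimpleGraph V) (A : Set V) (s : ℕ) (x : V) : Prop :=
  x ∉ A ∧ (∃! y, y ∈ A ∧ G.Adj x y) ∧
    TxZero G (Fset G A s x) ∧
    ∀ y : V, y ∉ A → (∃ a ∈ A, G.Adj y a) → y ≠ x →
      ∀ p : G.Walk y x, (∀ v ∈ p.support, v ∉ A) → ∃ v ∈ p.support, v ∉ sball G A s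

end GFF
namespace GFF

variable {V : Type} [Fintype V] {G : SimpleGraph V} {d : ℕ}

lemma tP_nonneg (u v : V) : 0 ≤ transP G d u v := by
  unfold transP; simp only [Matrix.of_apply]; split_ifs <;> positivity

lemma tP_symm (u v : V) : transP G d u v = transP G d v u := by
  unfold transP; simp only [Matrix.of_apply, G.adj_comm]

lemma tP_pos (hd : 3 ≤ d) {u v : V} (h : G.Adj u v) : 0 < transP G d u v := by
  unfold transP; simp only [Matrix.of_apply, h, if_true]
  have : 0 < d := by omega
  positivity

lemma tP_row (hd : 3 ≤ d) (hreg : IsReg G d) (u : V) : ∑ v, transP G d u v = 1 := by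
  unfold transP
  simp only [Matrix.of_apply]
  rw [← Finset.sum_filter, Finset.sum_const]
  have h := hreg u
  rw [Nat.card_eq_fintype_card, Fintype.card_subtype] at h
  have : (Finset.univ.filter fun v => G.Adj u v).card = d := by
    rw [← h]; congr 1
  rw [this]
  have : (d : ℝ) ≠ 0 := by positivity
  simp [this]

lemma max_principle (hd : 3 ≤ d) (hconn : G.Connected) (hreg : IsReg G d) (A : Set V)
    (hA : A.Nonempty) (f : V → ℝ) (h0 : ∀ z ∈ A, f z ≤ 0)
    (h1 : ∀ z ∉ A, f z ≤ ∑ w, transP G d z w * f w) (z : V) : f z ≤ 0 := by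
  have : Nonempty V := ⟨z⟩
  obtain ⟨m, hm⟩ := Finite.exists_max f
  by_contra! hz
  have hpos : 0 < f m := hz.trans_le (hm z)
  have step : ∀ u v, G.Adj u v → f u = f m → f v = f m := by
    intro u v huv hu
    have huA : u ∉ A := fun h => by have := h0 u h; linarith
    have h2 := h1 u huA
    by_contra hne
    have hlt : f v < f m := lt_of_le_of_ne (hm v) hne
    have : ∑ w, transP G d u w * f w < ∑ w, transP G d u w * f m := by
      apply Finset.sum_lt_sum
      · intro w _; exact mul_le_mul_of_nonneg_left (hm w) (tP_nonneg u w)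
      · exact ⟨v, Finset.mem_univ _, mul_lt_mul_of_pos_left hlt (tP_pos hd huv)⟩
    rw [← Finset.sum_mul, tP_row hd hreg, one_mul] at this
    linarith
  obtain ⟨a, ha⟩ := hA
  obtain ⟨p⟩ := hconn.preconnected m a
  have key : ∀ u v (p : G.Walk u v), f u = f m → f v = f m := by
    intro u v p
    induction p with
    | nil => exact id
    | cons h _ ih => exact fun hu => ih (step _ _ h hu)
  have := key _ _ p rfl
  have := h0 a ha
  linarith

/-- uniqueness for the Dirichlet problem -/
lemma dirichlet_unique (hd : 3 ≤ d) (hconn : G.Connected) (hreg : IsReg G d) (A : Set V)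
    (hA : A.Nonempty) (f : V → ℝ) (h0 : ∀ z ∈ A, f z = 0)
    (h1 : ∀ z ∉ A, f z = ∑ w, transP G d z w * f w) (z : V) : f z = 0 := by
  apply le_antisymm
  · exact max_principle hd hconn hreg A hA f (fun z hz => (h0 z hz).le) (fun z hz => (h1 z hz).le) z
  · have := max_principle hd hconn hreg A hA (fun z => - f z) (fun z hz => by simp [h0 z hz])
      (fun z hz => by simp only [mul_neg, Finset.sum_neg_distrib]; rw [← h1 z hz]) z
    linarith

/-- existence of a Lyapunov function -/
lemma exists_lyap (hd : 3 ≤ d) (hconn : G.Connected) (hreg : IsReg G d) (A : Set V)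
    (hA : A.Nonempty) : ∃ s : V → ℝ, (∀ z, 0 ≤ s z) ∧ (∀ z ∈ A, s z = 0) ∧
      (∀ z ∉ A, s z = 1 + ∑ w, transP G d z w * s w) := by
  let L : (V → ℝ) →ₗ[ℝ] (V → ℝ) :=
    { toFun := fun f z => if z ∈ A then f z else f z - ∑ w, transP G d z w * f w
      map_add' := by
        intro f g; ext z; simp only [Pi.add_apply]; split_ifs
        · rfl
        · simp only [mul_add, Finset.sum_add_distrib]; ring
      map_smul' := by
        intro c f; ext z; simp only [Pi.smul_apply, smul_eq_mul, RingHom.id_apply]; split_ifs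
        · rfl
        · rw [mul_sub, Finset.mul_sum]; congr 1; apply Finset.sum_congr rfl; intros; ring }
  have hL : ∀ f z, L f z = if z ∈ A then f z else f z - ∑ w, transP G d z w * f w :=
    fun _ _ => rfl
  have hinj : Function.Injective L := by
    rw [injective_iff_map_eq_zero]
    intro f hf
    ext z
    apply dirichlet_unique hd hconn hreg A hA f
    · intro z hz; have := congrFun hf z; rw [hL, if_pos hz] at this; exact this
    · intro z hz; have := congrFun hf z; rw [hL, if_neg hz] at this
      simp only [Pi.zero_apply] at this; linarith
  have hsurj := LinearMap.surjective_of_injective hinj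
  obtain ⟨s, hs⟩ := hsurj (fun z => if z ∈ A then 0 else 1)
  have hs0 : ∀ z ∈ A, s z = 0 := fun z hz => by
    have := congrFun hs z; rw [hL, if_pos hz] at this; simpa [hz] using this
  have hs1 : ∀ z ∉ A, s z = 1 + ∑ w, transP G d z w * s w := fun z hz => by
    have := congrFun hs z; rw [hL, if_neg hz] at this; simp only [hz, if_false] at this; linarith
  refine ⟨s, fun z => ?_, hs0, hs1⟩
  have := max_principle hd hconn hreg A hA (fun z => - s z) (fun z hz => by simp [hs0 z hz])
      (fun z hz => by simp only [mul_neg, Finset.sum_neg_distrib]; linarith [hs1 z hz]) z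
  linarith

/-- Dirichlet form is nonnegative -/
lemma dform_nonneg (hd : 3 ≤ d) (hreg : IsReg G d) (f : V → ℝ) :
    ∑ u, f u * ∑ v, transP G d u v * f v ≤ ∑ u, f u * f u := by
  have h1 : ∑ u, ∑ v, transP G d u v * (f u - f v) ^ 2 =
      2 * (∑ u, f u * f u - ∑ u, f u * ∑ v, transP G d u v * f v) := by
    have e1 : ∑ u, ∑ v, transP G d u v * f u ^ 2 = ∑ u, f u * f u := by
      apply Finset.sum_congr rfl; intro u _
      rw [← Finset.sum_mul, tP_row hd hreg]; ring
    have e2 : ∑ u, ∑ v, transP G d u v * f v ^ 2 = ∑ u, f u * f u := by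
      rw [Finset.sum_comm, ← e1]
      apply Finset.sum_congr rfl; intro u _
      apply Finset.sum_congr rfl; intro v _
      rw [tP_symm]
    have e3 : ∑ u, ∑ v, transP G d u v * (f u - f v) ^ 2 =
      ∑ u, ∑ v, transP G d u v * f u ^ 2 + ∑ u, ∑ v, transP G d u v * f v ^ 2
        - 2 * ∑ u, f u * ∑ v, transP G d u v * f v := by
      simp only [Finset.mul_sum]
      simp only [← Finset.sum_add_distrib, ← Finset.sum_sub_distrib]
      apply Finset.sum_congr rfl; intro u _
      apply Finset.sum_congr rfl; intro v _
      ring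
    rw [e3, e1, e2]; ring
  have h2 : 0 ≤ ∑ u, ∑ v, transP G d u v * (f u - f v) ^ 2 :=
    Finset.sum_nonneg fun u _ => Finset.sum_nonneg fun v _ =>
      mul_nonneg (tP_nonneg u v) (sq_nonneg _)
  linarith

/-- spectral decomposition in coordinates -/
lemma exists_eigen (hd : 3 ≤ d) (hconn : G.Connected) (hreg : IsReg G d) :
    ∃ (u : V → V → ℝ) (lam : V → ℝ),
      (∀ i x, ∑ w, transP G d x w * u i w = lam i * u i x) ∧
      (∀ f : V → ℝ, ∀ x, f x = ∑ i, (∑ w, u i w * f w) * u i x) ∧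
      (∀ i, lam i ≤ 1) ∧ (∀ i, lam i = 1 → ∀ x y, u i x = u i y) ∧
      (∀ i, lam i ≠ 1 → ∑ x, u i x = 0) := by
  have hH : (transP G d).IsHermitian := by
    ext i j; simp [tP_symm i j]
  have hev : ∀ i x, ∑ w, transP G d x w * hH.eigenvectorBasis i w
      = hH.eigenvalues i * hH.eigenvectorBasis i x := by
    intro i x
    have := congrFun (hH.mulVec_eigenvectorBasis i) x
    simpa [Matrix.mulVec, dotProduct] using this
  have hnz : ∀ i, 0 < ∑ w, hH.eigenvectorBasis i w * hH.eigenvectorBasis i w := by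
    intro i
    have := hH.eigenvectorBasis.orthonormal.1 i
    have h2 : ‖hH.eigenvectorBasis i‖ ^ 2 = 1 := by rw [this]; norm_num
    rw [EuclideanSpace.norm_sq_eq] at h2
    simp only [Real.norm_eq_abs, sq_abs] at h2
    simp only [← pow_two]
    rw [h2]; norm_num
  refine ⟨fun i x => hH.eigenvectorBasis i x, hH.eigenvalues, hev, ?_, ?_, ?_, ?_⟩
  · intro f x
    have := hH.eigenvectorBasis.sum_repr' (WithLp.toLp 2 f)
    have h2 := congrArg (fun v : EuclideanSpace ℝ V => v x) this
    simp only [WithLp.ofLp_sum, Finset.sum_apply, PiLp.smul_apply, PiLp.inner_apply,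
      smul_eq_mul] at h2
    rw [← h2]
    apply Finset.sum_congr rfl; intro i _
    congr 1
    apply Finset.sum_congr rfl; intro w _
    simp [mul_comm]
  · intro i
    have := dform_nonneg hd hreg (fun x => hH.eigenvectorBasis i x)
    simp only [hev] at this
    have e : ∑ u, hH.eigenvectorBasis i u * (hH.eigenvalues i * hH.eigenvectorBasis i u)
      = hH.eigenvalues i * ∑ u, hH.eigenvectorBasis i u * hH.eigenvectorBasis i u := by
      rw [Finset.mul_sum]; apply Finset.sum_congr rfl; intros; ring
    rw [e] at this
    nlinarith [hnz i]
  · intro i hi x y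
    have := dirichlet_unique hd hconn hreg {y} ⟨y, rfl⟩
      (fun x => hH.eigenvectorBasis i x - hH.eigenvectorBasis i y)
      (fun z hz => by rw [Set.mem_singleton_iff] at hz; simp [hz])
      (fun z _ => by
        simp only [mul_sub, Finset.sum_sub_distrib, hev, hi, ← Finset.sum_mul, tP_row hd hreg, one_mul]) x
    linarith
  · intro i hi
    have h1 : ∑ x, ∑ w, transP G d x w * hH.eigenvectorBasis i w
        = ∑ w, hH.eigenvectorBasis i w := by
      rw [Finset.sum_comm]
      apply Finset.sum_congr rfl; intro w _
      rw [← Finset.sum_mul]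
      simp only [tP_symm _ w, tP_row hd hreg, one_mul]
    simp only [hev, ← Finset.mul_sum] at h1
    have h3 : (hH.eigenvalues i - 1) * ∑ w, hH.eigenvectorBasis i w = 0 := by linarith
    rcases mul_eq_zero.mp h3 with h | h
    · exact absurd (by linarith) hi
    · exact h

lemma zGreen_symm (x y : V) (n : ℕ) : zGreen G d n x y = zGreen G d n y x := by
  have : ∀ k : ℕ, (transP G d ^ k) x y = (transP G d ^ k) y x := by
    intro k
    have : (transP G d).transpose = transP G d := by ext i j; simp [tP_symm i j]
    conv_lhs => rw [← this, ← Matrix.transpose_pow]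
    rfl
  simp only [zGreen, heatK, this]

lemma zGreen_eq (hd : 3 ≤ d) (hconn : G.Connected) (hreg : IsReg G d) (y : V) :
    (∑ x, zGreen G d (Fintype.card V) x y = 0) ∧
    ∀ x, zGreen G d (Fintype.card V) x y - ∑ w, transP G d x w * zGreen G d (Fintype.card V) w y
      = (if x = y then 1 else 0) - 1 / (Fintype.card V : ℝ) := by
  obtain ⟨u, lam, hev, hexp, hle, hconst, hsum⟩ := exists_eigen hd hconn hreg
  have : Nonempty V := ⟨y⟩
  have hN : (Fintype.card V : ℝ) ≠ 0 := by positivity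
  set N : ℝ := (Fintype.card V : ℝ) with hNdef
  let f : V → ℝ := fun x => (if x = y then 1 else 0) - 1 / N
  let a : V → ℝ := fun i => ∑ w, u i w * f w
  have ha : ∀ i, lam i = 1 → a i = 0 := by
    intro i hi
    have : ∀ w, u i w = u i y := fun w => hconst i hi w y
    simp only [a, f, this, ← Finset.mul_sum, Finset.sum_sub_distrib]
    simp [← hNdef, hN]
  have hf : ∀ x, f x = ∑ i, a i * u i x := fun x => hexp f x
  have hpow : ∀ k x, (transP G d ^ k) x y - 1 / N = ∑ i, a i * lam i ^ k * u i x := by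
    intro k
    induction k with
    | zero => intro x; simp only [pow_zero, mul_one, ← hf]; simp [f, Matrix.one_apply]
    | succ k ih =>
      intro x
      have : (transP G d ^ (k+1)) x y - 1 / N
          = ∑ w, transP G d x w * ((transP G d ^ k) w y - 1 / N) := by
        simp only [mul_sub, Finset.sum_sub_distrib, ← Finset.sum_mul, tP_row hd hreg, one_mul]
        rw [pow_succ', Matrix.mul_apply]
      rw [this]
      simp only [ih, Finset.mul_sum]
      rw [Finset.sum_comm]
      apply Finset.sum_congr rfl; intro i _
      have := hev i x
      calc _ = a i * lam i ^ k * ∑ w, transP G d x w * u i w := by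
              rw [Finset.mul_sum]; apply Finset.sum_congr rfl; intros; ring
        _ = _ := by rw [this]; ring
  have hexpS : ∀ t c : ℝ, HasSum (fun k : ℕ => Real.exp (-t) * t ^ k / (Nat.factorial k) * c ^ k)
      (Real.exp (-(1 - c) * t)) := by
    intro t c
    have h1 := NormedSpace.expSeries_div_hasSum_exp (𝔸 := ℝ) (t * c)
    rw [← Real.exp_eq_exp_ℝ] at h1
    have h2 := h1.mul_left (Real.exp (-t))
    rw [← Real.exp_add] at h2
    have e1 : (fun k : ℕ => Real.exp (-t) * t ^ k / (Nat.factorial k) * c ^ k) =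
        fun k : ℕ => Real.exp (-t) * ((t * c) ^ k / (Nat.factorial k)) := by
      funext k; rw [mul_pow]; ring
    have e2 : -(1 - c) * t = -t + t * c := by ring
    rw [e1, e2]
    exact h2
  have hheat : ∀ t x, heatK G d t x y - 1 / N = ∑ i, a i * u i x * Real.exp (-(1 - lam i) * t) := by
    intro t x
    have h1 : HasSum (fun k : ℕ => Real.exp (-t) * t ^ k / (Nat.factorial k) *
        (1 / N * 1 ^ k + ∑ i, a i * lam i ^ k * u i x))
        (1 / N * Real.exp (-(1 - 1) * t) + ∑ i, a i * u i x * Real.exp (-(1 - lam i) * t)) := by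
      have e1 := (hexpS t 1).mul_left (1 / N)
      have e2 := hasSum_sum (s := Finset.univ)
        (fun i _ => (hexpS t (lam i)).mul_left (a i * u i x))
      refine (e1.add e2).congr_fun ?_
      intro k
      rw [mul_add, Finset.mul_sum]
      congr 1
      · ring
      · apply Finset.sum_congr rfl; intros; ring
    have h2 : heatK G d t x y = 1 / N * Real.exp (-(1 - 1) * t) +
        ∑ i, a i * u i x * Real.exp (-(1 - lam i) * t) := by
      unfold heatK
      rw [← h1.tsum_eq]
      congr 1; ext k
      rw [← hpow]; congr 1; ring
    rw [h2]; simp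
  have hint : ∀ i x, IntegrableOn (fun t => a i * u i x * Real.exp (-(1 - lam i) * t)) (Ioi 0) ∧
      ∫ t in Ioi (0:ℝ), a i * u i x * Real.exp (-(1 - lam i) * t) = a i / (1 - lam i) * u i x := by
    intro i x
    by_cases h : lam i = 1
    · simp [ha i h]
    · have hlt : 0 < 1 - lam i := by have := lt_of_le_of_ne (hle i) h; linarith
      constructor
      · exact (exp_neg_integrableOn_Ioi 0 hlt).const_mul _
      · rw [MeasureTheory.integral_const_mul, integral_exp_mul_Ioi (by linarith)]
        field_simp; simp
  have hK : ∀ x, zGreen G d (Fintype.card V) x y = ∑ i, a i / (1 - lam i) * u i x := by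
    intro x
    unfold zGreen
    rw [← hNdef]
    simp only [hheat]
    rw [MeasureTheory.integral_finsetSum _ (fun i _ => (hint i x).1)]
    exact Finset.sum_congr rfl fun i _ => (hint i x).2
  constructor
  · simp only [hK]
    rw [Finset.sum_comm]
    apply Finset.sum_eq_zero; intro i _
    rw [← Finset.mul_sum]
    by_cases h : lam i = 1
    · simp [ha i h]
    · simp [hsum i h]
  · intro x
    simp only [hK, Finset.mul_sum]
    rw [Finset.sum_comm, ← Finset.sum_sub_distrib]
    have := hf x
    simp only [f] at this
    rw [this]
    apply Finset.sum_congr rfl; intro i _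
    have e : ∑ w, transP G d x w * (a i / (1 - lam i) * u i w)
      = a i / (1 - lam i) * (lam i * u i x) := by
      rw [← hev, Finset.mul_sum]; apply Finset.sum_congr rfl; intros; ring
    rw [e]
    by_cases h : lam i = 1
    · simp [ha i h]
    · have : 1 - lam i ≠ 0 := fun h' => h (by linarith)
      field_simp

lemma zGreen_psd (hd : 3 ≤ d) (hconn : G.Connected) (hreg : IsReg G d) (c : V → ℝ) :
    0 ≤ ∑ i, ∑ j, c i * c j * zGreen G d (Fintype.card V) i j := by
  set K := zGreen G d (Fintype.card V) with hK
  let g : V → ℝ := fun x => ∑ j, c j * K x j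
  have h0 : ∑ x, g x = 0 := by
    simp only [g]; rw [Finset.sum_comm]
    apply Finset.sum_eq_zero; intro j _
    rw [← Finset.mul_sum, (zGreen_eq hd hconn hreg j).1, mul_zero]
  have h1 : ∀ x, g x - ∑ w, transP G d x w * g w = c x - (∑ j, c j) / Fintype.card V := by
    intro x
    have e : g x - ∑ w, transP G d x w * g w
        = ∑ j, c j * (K x j - ∑ w, transP G d x w * K w j) := by
      simp only [g, mul_sub, Finset.sum_sub_distrib, Finset.mul_sum]
      congr 1
      rw [Finset.sum_comm]
      apply Finset.sum_congr rfl; intro u _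
      apply Finset.sum_congr rfl; intro v _
      ring
    rw [e]
    simp only [hK, (zGreen_eq hd hconn hreg _).2, mul_sub, Finset.sum_sub_distrib, Finset.sum_div]
    simp [div_eq_mul_inv]
  have h2 := dform_nonneg hd hreg g
  have h3 : ∑ i, ∑ j, c i * c j * K i j = ∑ x, g x * c x := by
    simp only [g, Finset.sum_mul]
    apply Finset.sum_congr rfl; intro u _
    apply Finset.sum_congr rfl; intro v _
    ring
  rw [h3]
  have h4 : ∑ x, g x * c x = ∑ x, g x * (g x - ∑ w, transP G d x w * g w) := by
    simp only [h1, mul_sub (g _) (c _), Finset.sum_sub_distrib, ← Finset.sum_mul, h0]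
    ring
  rw [h4]
  simp only [mul_sub, Finset.sum_sub_distrib]
  linarith

end GFF
namespace GFF

section walk
variable {V : Type} [Fintype V] [MeasurableSpace V] {G : SimpleGraph V} {d : ℕ}
  {W : V → Measure (ℕ → V)}

lemma srw_start (hW : IsSRW G d W) (x y : V) : W x {ω | ω 0 = y} = if y = x then 1 else 0 := by
  have := hW.2 x 0 (fun _ => y)
  simpa using this

lemma srw_sep (hW : IsSRW G d W) (x y : V) (hxy : x ≠ y) :
    ∃ S : Set V, MeasurableSet S ∧ x ∈ S ∧ y ∉ S := by
  by_contra! hcon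
  have hiff : ∀ S : Set V, MeasurableSet S → (x ∈ S ↔ y ∈ S) := by
    intro S hS
    refine ⟨hcon S hS, fun hy => ?_⟩
    by_contra hx
    exact hcon Sᶜ hS.compl hx hy
  let f : V → V := fun v => if v = y then x else v
  let F : (ℕ → V) → (ℕ → V) := fun ω n => f (ω n)
  have hF : ∀ T : Set (ℕ → V), MeasurableSet T → F ⁻¹' T = T := by
    intro T hT
    rw [MeasurableSpace.pi, MeasurableSpace.measurableSet_iSup] at hT
    induction hT with
    | basic u hu =>
      obtain ⟨i, hu⟩ := hu
      obtain ⟨S, hS, rfl⟩ := hu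
      ext ω
      simp only [mem_preimage, F, f]
      split_ifs with h
      · rw [h]; exact hiff S hS
      · rfl
    | empty => simp
    | compl t _ ih => rw [preimage_compl, ih]
    | iUnion s _ ih => rw [preimage_iUnion]; simp only [ih]
  have h0 := srw_start hW x y
  have h1 := srw_start hW x x
  rw [if_neg hxy.symm] at h0
  rw [if_pos rfl] at h1
  obtain ⟨t, hst, ht, hmt⟩ := exists_measurable_superset_of_null h0
  have hsub : {ω : ℕ → V | ω 0 = x} ⊆ t := by
    intro ω hω
    have hω' : Function.update ω 0 y ∈ t := hst (by simp)
    have e : F (Function.update ω 0 y) = F ω := by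
      funext n
      simp only [F, f]
      rcases Nat.eq_zero_or_pos n with rfl | hn
      · simp only [mem_ofPred_eq] at hω
        simp [hω]
      · rw [Function.update_of_ne (by omega)]
    rw [← hF t ht, mem_preimage, e] at hω'
    rw [← hF t ht]; exact hω'
  have := measure_mono_null hsub hmt
  rw [h1] at this
  exact one_ne_zero this

lemma srw_msc (hW : IsSRW G d W) : MeasurableSingletonClass V := by
  constructor
  intro x
  have hex : ∀ y : V, ∃ S : Set V, MeasurableSet S ∧ x ∈ S ∧ (y ≠ x → y ∉ S) := by
    intro y
    by_cases h : x = y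
    · exact ⟨univ, MeasurableSet.univ, mem_univ _, fun h' => absurd h.symm h'⟩
    · obtain ⟨S, h1, h2, h3⟩ := srw_sep hW x y h
      exact ⟨S, h1, h2, fun _ => h3⟩
  choose S h1 h2 h3 using hex
  have : ({x} : Set V) = ⋂ y, S y := by
    ext z
    simp only [mem_singleton_iff, mem_iInter]
    constructor
    · rintro rfl; exact h2
    · intro hz; by_contra hne; exact h3 z hne (hz z)
  rw [this]
  exact MeasurableSet.iInter h1

/-- prepend a vertex -/
def consW (z : V) (p : ℕ → V) : ℕ → V
  | 0 => z
  | n + 1 => p n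

lemma consW_meas (z : V) : Measurable (consW z) := by
  rw [measurable_pi_iff]
  intro n
  cases n with
  | zero => exact measurable_const
  | succ n => exact measurable_pi_apply n

lemma step_eq (hd : 3 ≤ d) (u v : V) : srwStep G d u v = ENNReal.ofReal (transP G d u v) := by
  unfold srwStep transP
  simp only [Matrix.of_apply]
  split_ifs
  · rw [ENNReal.ofReal_inv_of_pos (by positivity)]; simp
  · simp

lemma step_row (hd : 3 ≤ d) (hreg : IsReg G d) (u : V) : ∑ v, srwStep G d u v = 1 := by
  simp only [step_eq hd]
  rw [← ENNReal.ofReal_sum_of_nonneg (fun v _ => tP_nonneg u v), tP_row hd hreg]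
  simp

lemma cyl_gen [MeasurableSingletonClass V] : (MeasurableSpace.pi : MeasurableSpace (ℕ → V)) =
    MeasurableSpace.generateFrom
      {S | ∃ (k : ℕ) (p : ℕ → V), S = {ω | ∀ i ≤ k, ω i = p i}} := by
  apply le_antisymm
  · rw [MeasurableSpace.pi]
    apply iSup_le
    intro i
    rw [← measurable_iff_comap_le]
    let _ : MeasurableSpace (ℕ → V) := MeasurableSpace.generateFrom
      {S | ∃ (k : ℕ) (p : ℕ → V), S = {ω | ∀ i ≤ k, ω i = p i}}
    apply measurable_to_countable'
    intro v
    have : ((fun b : ℕ → V => b i) ⁻¹' {v}) =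
        ⋃ q ∈ {q : Fin (i+1) → V | q ⟨i, by omega⟩ = v},
          {ω : ℕ → V | ∀ j ≤ i, ω j = if h : j < i + 1 then q ⟨j, h⟩ else v} := by
      ext ω
      simp only [mem_preimage, mem_singleton_iff, mem_iUnion, mem_ofPred_eq, exists_prop]
      constructor
      · intro h
        refine ⟨fun j => ω j, h, ?_⟩
        intro j hj
        rw [dif_pos (by omega)]
      · rintro ⟨q, hq, h⟩
        rw [h i le_rfl, dif_pos (by omega), hq]
    rw [this]
    apply MeasurableSet.biUnion (Set.to_countable _)
    intro q _
    apply MeasurableSpace.measurableSet_generateFrom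
    exact ⟨i, fun j => if h : j < i + 1 then q ⟨j, h⟩ else v, rfl⟩
  · apply MeasurableSpace.generateFrom_le
    rintro S ⟨k, p, rfl⟩
    have : {ω : ℕ → V | ∀ i ≤ k, ω i = p i} = ⋂ i, ⋂ (_ : i ≤ k), (fun ω => ω i) ⁻¹' {p i} := by
      ext; simp
    rw [this]
    exact MeasurableSet.iInter fun i => MeasurableSet.iInter fun _ =>
      measurable_pi_apply i (measurableSet_singleton _)

lemma cyl_pi : IsPiSystem
      {S : Set (ℕ → V) | ∃ (k : ℕ) (p : ℕ → V), S = {ω | ∀ i ≤ k, ω i = p i}} := by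
  rintro _ ⟨k, p, rfl⟩ _ ⟨l, q, rfl⟩ ⟨ω, h1, h2⟩
  refine ⟨max k l, ω, ?_⟩
  ext η
  simp only [mem_inter_iff, mem_ofPred_eq] at *
  constructor
  · rintro ⟨h3, h4⟩ i hi
    rcases le_max_iff.mp hi with h | h
    · rw [h3 i h, h1 i h]
    · rw [h4 i h, h2 i h]
  · intro h
    exact ⟨fun i hi => by rw [h i (le_max_of_le_left hi), h1 i hi],
      fun i hi => by rw [h i (le_max_of_le_right hi), h2 i hi]⟩

lemma W_rec (hd : 3 ≤ d) (hreg : IsReg G d) (hW : IsSRW G d W) (z : V) :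
    W z = ∑ w, srwStep G d z w • (W w).map (consW z) := by
  have := srw_msc hW
  have := hW.1
  apply ext_of_generate_finite _ cyl_gen cyl_pi
  · rintro _ ⟨k, p, rfl⟩
    have hm : MeasurableSet {ω : ℕ → V | ∀ i ≤ k, ω i = p i} := by
      rw [cyl_gen]
      exact MeasurableSpace.measurableSet_generateFrom ⟨k, p, rfl⟩
    rw [hW.2 z k p, Measure.finsetSum_apply]
    simp only [Measure.smul_apply, Measure.map_apply (consW_meas z) hm, smul_eq_mul]
    by_cases hp : p 0 = z
    swap
    · have : (consW z) ⁻¹' {ω : ℕ → V | ∀ i ≤ k, ω i = p i} = ∅ := by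
        ext q
        simp only [mem_preimage, mem_ofPred_eq, mem_empty_iff_false, iff_false]
        intro h
        exact hp (h 0 (Nat.zero_le _)).symm
      simp [this, hp]
    · cases k with
      | zero =>
        have : (consW z) ⁻¹' {ω : ℕ → V | ∀ i ≤ 0, ω i = p i} = univ := by
          ext q
          simp [consW, hp]
        rw [this]
        simp [hp, step_row hd hreg]
      | succ k =>
        have : (consW z) ⁻¹' {ω : ℕ → V | ∀ i ≤ k + 1, ω i = p i} =
            {ω | ∀ i ≤ k, ω i = p (i + 1)} := by
          ext q
          simp only [mem_preimage, mem_ofPred_eq]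
          constructor
          · intro h i hi; exact h (i+1) (by omega)
          · intro h i hi
            cases i with
            | zero => exact hp.symm
            | succ i => exact h i (by omega)
        rw [this]
        have h2 : ∀ w, W w {ω | ∀ i ≤ k, ω i = p (i + 1)} = _ :=
          fun w => hW.2 w k (fun i => p (i+1))
        simp only [h2, hp, if_true, one_mul]
        rw [Finset.prod_range_succ']
        simp only [ite_mul, one_mul, zero_mul, mul_ite, mul_zero, zero_add, hp]
        rw [Finset.sum_ite_eq]
        simp [mul_comm]
  · rw [measure_univ, Measure.finsetSum_apply]
    simp only [Measure.smul_apply, Measure.map_apply (consW_meas z) MeasurableSet.univ, smul_eq_mul]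
    simp [step_row hd hreg]

lemma lint_rec (hd : 3 ≤ d) (hreg : IsReg G d) (hW : IsSRW G d W) (z : V)
    (F : (ℕ → V) → ℝ≥0∞) (hF : Measurable F) :
    ∫⁻ p, F p ∂ W z = ∑ w, ENNReal.ofReal (transP G d z w) * ∫⁻ p, F (consW z p) ∂ W w := by
  rw [W_rec hd hreg hW z, lintegral_finsetSum_measure]
  simp only [lintegral_smul_measure, lintegral_map hF (consW_meas z), step_eq hd, smul_eq_mul]

lemma int_rec (hd : 3 ≤ d) (hreg : IsReg G d) (hW : IsSRW G d W) (z : V)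
    (F : (ℕ → V) → ℝ) (hF : Measurable F) (hi : ∀ w, Integrable (fun p => F (consW z p)) (W w)) :
    ∫ p, F p ∂ W z = ∑ w, transP G d z w * ∫ p, F (consW z p) ∂ W w := by
  rw [W_rec hd hreg hW z, integral_finsetSum_measure]
  · simp only [integral_smul_measure, step_eq hd, smul_eq_mul]
    apply Finset.sum_congr rfl; intro w _
    rw [integral_map (consW_meas z).aemeasurable hF.aestronglyMeasurable,
      ENNReal.toReal_ofReal (tP_nonneg z w)]
  · intro w _
    apply Integrable.smul_measure
    · rw [integrable_map_measure hF.aestronglyMeasurable (consW_meas z).aemeasurable]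
      exact hi w
    · rw [step_eq hd]; exact ENNReal.ofReal_ne_top

/-- integer valued hitting time -/
noncomputable def tau (A : Set V) (p : ℕ → V) : ℕ := sInf {k | p k ∈ A}

lemma hit_toNat (A : Set V) (p : ℕ → V) : (hitTime A p).toNat = tau A p := by
  unfold hitTime tau
  by_cases h : {k | p k ∈ A}.Nonempty
  · have h1 : sInf ((Nat.cast : ℕ → ℕ∞) '' {k | p k ∈ A}) = ((sInf {k | p k ∈ A} : ℕ) : ℕ∞) := by
      apply le_antisymm
      · exact sInf_le ⟨_, Nat.sInf_mem h, rfl⟩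
      · apply le_sInf
        rintro _ ⟨k, hk, rfl⟩
        exact_mod_cast Nat.sInf_le hk
    rw [h1]; simp
  · rw [not_nonempty_iff_eq_empty] at h
    simp [h]

lemma stop_eq (A : Set V) (p : ℕ → V) : stopAt A p = p (tau A p) := by
  unfold stopAt; rw [hit_toNat]

lemma tau_zero {A : Set V} {p : ℕ → V} (h : p 0 ∈ A) : tau A p = 0 :=
  Nat.sInf_eq_zero.mpr (Or.inl h)

lemma tau_cons {A : Set V} {z : V} {p : ℕ → V} (hz : z ∉ A) (h : ∃ k, p k ∈ A) :
    tau A (consW z p) = tau A p + 1 := by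
  have hm : p (tau A p) ∈ A := Nat.sInf_mem h
  apply le_antisymm
  · exact Nat.sInf_le hm
  · have hm2 : consW z p (tau A (consW z p)) ∈ A := by
      obtain ⟨k, hk⟩ := h
      exact Nat.sInf_mem (s := {k | consW z p k ∈ A}) ⟨k+1, hk⟩
    cases hc : tau A (consW z p) with
    | zero => rw [hc] at hm2; exact absurd hm2 hz
    | succ n =>
      rw [hc] at hm2
      have : tau A p ≤ n := Nat.sInf_le hm2
      omega

lemma tau_cons_le {A : Set V} {z : V} {p : ℕ → V} (hz : z ∉ A)  :
    tau A (consW z p) ≤ tau A p + 1 := by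
  by_cases h : ∃ k, p k ∈ A
  · exact (tau_cons hz h).le
  · have : tau A (consW z p) = 0 := by
      apply Nat.sInf_eq_zero.mpr (Or.inr _)
      ext k
      simp only [mem_ofPred_eq, mem_empty_iff_false, iff_false]
      cases k with
      | zero => exact hz
      | succ k => exact fun h' => h ⟨k, h'⟩
    omega

lemma stop_cons {A : Set V} {z : V} {p : ℕ → V} (hz : z ∉ A) (h : ∃ k, p k ∈ A) :
    stopAt A (consW z p) = stopAt A p := by
  rw [stop_eq, stop_eq, tau_cons hz h]; rfl

lemma nohit_meas [MeasurableSingletonClass V] (A : Set V) :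
    MeasurableSet {p : ℕ → V | ∀ k, p k ∉ A} := by
  have : {p : ℕ → V | ∀ k, p k ∉ A} = ⋂ k, (fun p => p k) ⁻¹' Aᶜ := by ext; simp
  rw [this]
  exact MeasurableSet.iInter fun k => measurable_pi_apply k (Set.toFinite _).measurableSet

lemma tau_meas [MeasurableSingletonClass V] (A : Set V) :
    Measurable (tau A : (ℕ → V) → ℕ) := by
  apply measurable_of_Iic
  intro n
  have : (tau A : (ℕ → V) → ℕ) ⁻¹' Iic n =
      (⋃ k, ⋃ (_ : k ≤ n), (fun p => p k) ⁻¹' A) ∪ {p : ℕ → V | ∀ k, p k ∉ A} := by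
    ext p
    simp only [mem_preimage, mem_Iic, mem_union, mem_iUnion, mem_ofPred_eq, exists_prop]
    constructor
    · intro h
      by_cases hh : ∃ k, p k ∈ A
      · exact Or.inl ⟨tau A p, h, Nat.sInf_mem hh⟩
      · right; push Not at hh; exact hh
    · rintro (⟨k, hk, hp⟩ | h)
      · exact (Nat.sInf_le hp).trans hk
      · have : tau A p = 0 := Nat.sInf_eq_zero.mpr (Or.inr (by ext k; simp [h k]))
        omega
  rw [this]
  exact (MeasurableSet.iUnion fun k => MeasurableSet.iUnion fun _ =>
    measurable_pi_apply k (Set.toFinite _).measurableSet).union (nohit_meas A)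

lemma stop_meas [MeasurableSingletonClass V] (A : Set V) :
    Measurable (stopAt A : (ℕ → V) → V) := by
  apply measurable_to_countable'
  intro a
  have : (stopAt A : (ℕ → V) → V) ⁻¹' {a} =
      ⋃ n, (tau A ⁻¹' {n} ∩ (fun p => p n) ⁻¹' {a}) := by
    ext p
    simp [stop_eq]
  rw [this]
  exact MeasurableSet.iUnion fun n => (tau_meas A (measurableSet_singleton _)).inter
    (measurable_pi_apply n (measurableSet_singleton _))

lemma start_ae (hW : IsSRW G d W) (z : V) : ∀ᵐ p ∂ W z, p 0 = z := by
  have := srw_msc hW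
  have := hW.1 z
  have hm : MeasurableSet {p : ℕ → V | p 0 = z} := by
    have h : MeasurableSet ((fun p : ℕ → V => p 0) ⁻¹' {z}) :=
      measurable_pi_apply 0 (measurableSet_singleton z)
    exact h
  have h1 : W z {p : ℕ → V | p 0 = z} = 1 := by rw [srw_start hW]; simp
  exact (mem_ae_iff_prob_eq_one hm).mpr h1

lemma hit_ae (hd : 3 ≤ d) (hconn : G.Connected) (hreg : IsReg G d) (hW : IsSRW G d W)
    (A : Set V) (hA : A.Nonempty) (z : V) : ∀ᵐ p ∂ W z, ∃ k, p k ∈ A := by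
  have := srw_msc hW
  have := hW.1
  have hm := nohit_meas A
  have key := dirichlet_unique hd hconn hreg A hA (fun z => (W z {p | ∀ k, p k ∉ A}).toReal)
    (by
      intro z hz
      have : W z {p | ∀ k, p k ∉ A} = 0 := by
        have h0 : ∀ᵐ p ∂ W z, ¬ ∀ k, p k ∉ A := by
          filter_upwards [start_ae hW z] with p hp h
          exact h 0 (hp ▸ hz)
        rw [ae_iff] at h0
        simpa using h0
      simp [this])
    (by
      intro z hz
      have h1 := lint_rec hd hreg hW z (indicator {p | ∀ k, p k ∉ A} 1)
        (measurable_one.indicator hm)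
      rw [lintegral_indicator_one hm] at h1
      have h2 : ∀ w, ∫⁻ p, indicator {p | ∀ k, p k ∉ A} 1 (consW z p) ∂ W w
          = W w {p | ∀ k, p k ∉ A} := by
        intro w
        rw [← lintegral_indicator_one hm]
        congr 1; ext p
        have : (consW z p ∈ {p | ∀ k, p k ∉ A}) ↔ p ∈ {p | ∀ k, p k ∉ A} := by
          simp only [mem_ofPred_eq]
          constructor
          · intro h k; exact h (k+1)
          · intro h k
            cases k with
            | zero => exact hz
            | succ k => exact h k
        simp only [indicator, this]
        rfl
      simp only [h2] at h1
      rw [h1, ENNReal.toReal_sum]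
      · simp only [ENNReal.toReal_mul, ENNReal.toReal_ofReal (tP_nonneg _ _)]
      · intro w _; exact ENNReal.mul_ne_top ENNReal.ofReal_ne_top (measure_ne_top _ _)) z
  rw [ae_iff]
  simp only [ENNReal.toReal_eq_zero_iff, measure_ne_top, or_false] at key
  simpa using key

lemma tau_int (hd : 3 ≤ d) (hconn : G.Connected) (hreg : IsReg G d) (hW : IsSRW G d W)
    (A : Set V) (hA : A.Nonempty) (z : V) : Integrable (fun p => (tau A p : ℝ)) (W z) := by
  have := srw_msc hW
  have := hW.1
  obtain ⟨s, hs, hs0, hs1⟩ := exists_lyap hd hconn hreg A hA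
  have hmeas : ∀ n : ℕ, Measurable (fun p : ℕ → V => ((min (tau A p) n : ℕ) : ℝ≥0∞)) := by
    intro n
    exact measurable_from_nat.comp ((tau_meas A).min measurable_const)
  have hb : ∀ n : ℕ, ∀ z, ∫⁻ p, ((min (tau A p) n : ℕ) : ℝ≥0∞) ∂ W z ≤ ENNReal.ofReal (s z) := by
    intro n
    induction n with
    | zero => intro z; simp
    | succ n ih =>
      intro z
      by_cases hz : z ∈ A
      · have : ∫⁻ p, ((min (tau A p) (n+1) : ℕ) : ℝ≥0∞) ∂ W z = ∫⁻ p, 0 ∂ W z := by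
          apply lintegral_congr_ae
          filter_upwards [start_ae hW z] with p hp
          rw [tau_zero (hp ▸ hz)]; simp
        rw [this]; simp
      · rw [lint_rec hd hreg hW z _ (hmeas (n+1)), hs1 z hz]
        have e : ENNReal.ofReal (1 + ∑ w, transP G d z w * s w) =
            ∑ w, ENNReal.ofReal (transP G d z w) * (1 + ENNReal.ofReal (s w)) := by
          have : (1 + ∑ w, transP G d z w * s w) = ∑ w, transP G d z w * (1 + s w) := by
            simp only [mul_add, mul_one, Finset.sum_add_distrib, tP_row hd hreg]
          rw [this, ENNReal.ofReal_sum_of_nonneg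
            (fun w _ => mul_nonneg (tP_nonneg _ _) (by linarith [hs w]))]
          apply Finset.sum_congr rfl; intro w _
          rw [ENNReal.ofReal_mul (tP_nonneg _ _), ENNReal.ofReal_add zero_le_one (hs w),
            ENNReal.ofReal_one]
        rw [e]
        gcongr with w _
        calc ∫⁻ p, ((min (tau A (consW z p)) (n+1) : ℕ) : ℝ≥0∞) ∂ W w
            ≤ ∫⁻ p, (1 + ((min (tau A p) n : ℕ) : ℝ≥0∞)) ∂ W w := by
              apply lintegral_mono
              intro p
              have := tau_cons_le (p := p) hz
              have h2 : min (tau A (consW z p)) (n+1) ≤ 1 + min (tau A p) n := by omega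
              have h3 : ((min (tau A (consW z p)) (n+1) : ℕ) : ℝ≥0∞) ≤
                  ((1 + min (tau A p) n : ℕ) : ℝ≥0∞) := by exact_mod_cast h2
              simpa only [Nat.cast_add, Nat.cast_one] using h3
          _ = 1 + ∫⁻ p, ((min (tau A p) n : ℕ) : ℝ≥0∞) ∂ W w := by
              rw [lintegral_add_left measurable_const]; simp
          _ ≤ _ := by gcongr; exact ih w
  have hsup : ∫⁻ p, (tau A p : ℝ≥0∞) ∂ W z ≤ ENNReal.ofReal (s z) := by
    have e : ∀ p : ℕ → V, (tau A p : ℝ≥0∞) = ⨆ n : ℕ, ((min (tau A p) n : ℕ) : ℝ≥0∞) := by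
      intro p
      apply le_antisymm
      · exact le_iSup_of_le (tau A p) (by simp)
      · apply iSup_le; intro n; exact_mod_cast min_le_left _ _
    simp only [e]
    rw [lintegral_iSup hmeas]
    · exact iSup_le fun n => hb n z
    · intro m n hmn p
      have : min (tau A p) m ≤ min (tau A p) n := min_le_min_left _ hmn
      have h3 : ((min (tau A p) m : ℕ) : ℝ≥0∞) ≤ ((min (tau A p) n : ℕ) : ℝ≥0∞) := by
        exact_mod_cast this
      exact h3
  refine ⟨(measurable_from_nat.comp (tau_meas A)).aestronglyMeasurable, ?_⟩
  unfold HasFiniteIntegral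
  refine lt_of_le_of_lt ?_ (lt_of_le_of_lt hsup ENNReal.ofReal_lt_top)
  apply lintegral_mono
  intro p
  simp

lemma walk_facts (hd : 3 ≤ d) (hconn : G.Connected) (hreg : IsReg G d) (hW : IsSRW G d W)
    (A : Set V) (hA : A.Nonempty) :
    ∃ (h : V → V → ℝ) (T : V → ℝ),
      (∀ x (f : V → ℝ), ∫ p, f (stopAt A p) ∂ W x = ∑ a, h x a * f a) ∧
      (∀ x, ∫ p, ((hitTime A p).toNat : ℝ) ∂ W x = T x) ∧
      (∀ x, ∀ a ∉ A, h x a = 0) ∧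
      (∀ z ∈ A, ∀ f : V → ℝ, ∑ a, h z a * f a = f z) ∧
      (∀ z ∉ A, ∀ f : V → ℝ, ∑ a, h z a * f a =
        ∑ w, transP G d z w * ∑ a, h w a * f a) ∧
      (∀ z, 0 ≤ T z) ∧ (∀ z ∈ A, T z = 0) ∧
      (∀ z ∉ A, T z = 1 + ∑ w, transP G d z w * T w) := by
  have := srw_msc hW
  have := hW.1
  have hfm : ∀ f : V → ℝ, Measurable f := fun f => measurable_of_finite f
  have hint : ∀ x (f : V → ℝ), Integrable (fun p => f (stopAt A p)) (W x) := by
    intro x f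
    refine Integrable.of_bound ((hfm f).comp (stop_meas A)).aestronglyMeasurable (∑ a, |f a|) ?_
    refine Eventually.of_forall fun p => ?_
    exact Finset.single_le_sum (f := fun a => |f a|) (fun _ _ => abs_nonneg _) (Finset.mem_univ _)
  let h : V → V → ℝ := fun x a => ∫ p, (if stopAt A p = a then (1:ℝ) else 0) ∂ W x
  have h1 : ∀ x (f : V → ℝ), ∫ p, f (stopAt A p) ∂ W x = ∑ a, h x a * f a := by
    intro x f
    have e : ∀ p, f (stopAt A p) = ∑ a, (if stopAt A p = a then (1:ℝ) else 0) * f a := by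
      intro p; simp
    simp only [e]
    rw [integral_finsetSum]
    · simp only [integral_mul_const, h]
    · intro a _
      exact (hint x (fun v => if v = a then 1 else 0)).mul_const _
  have h4 : ∀ z ∈ A, ∀ f : V → ℝ, ∑ a, h z a * f a = f z := by
    intro z hz f
    rw [← h1]
    have : ∫ p, f (stopAt A p) ∂ W z = ∫ p, f z ∂ W z := by
      apply integral_congr_ae
      filter_upwards [start_ae hW z] with p hp
      rw [stop_eq, tau_zero (hp ▸ hz), hp]
    rw [this]; simp
  have hcongr : ∀ z ∉ A, ∀ (f : V → ℝ) w, (fun p => f (stopAt A (consW z p))) =ᵐ[W w]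
      fun p => f (stopAt A p) := by
    intro z hz f w
    filter_upwards [hit_ae hd hconn hreg hW A hA w] with p hp
    rw [stop_cons hz hp]
  have h5 : ∀ z ∉ A, ∀ f : V → ℝ, ∑ a, h z a * f a =
        ∑ w, transP G d z w * ∑ a, h w a * f a := by
    intro z hz f
    simp only [← h1]
    rw [int_rec hd hreg hW z (fun p => f (stopAt A p)) ((hfm f).comp (stop_meas A))
      (fun w => (hint w f).congr (hcongr z hz f w).symm)]
    apply Finset.sum_congr rfl; intro w _
    rw [integral_congr_ae (hcongr z hz f w)]
  refine ⟨h, fun x => ∫ p, (tau A p : ℝ) ∂ W x, h1, ?_, ?_, h4, h5, ?_, ?_, ?_⟩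
  · intro x; simp only [hit_toNat]
  · intro x a ha
    apply dirichlet_unique hd hconn hreg A hA (fun x => h x a)
    · intro z hz
      have := h4 z hz (fun v => if v = a then 1 else 0)
      have hza : z ≠ a := fun e => ha (e ▸ hz)
      simpa [hza] using this
    · intro z hz
      have := h5 z hz (fun v => if v = a then 1 else 0)
      simpa using this
  · intro z; exact integral_nonneg fun p => Nat.cast_nonneg _
  · intro z hz
    have : ∫ p, (tau A p : ℝ) ∂ W z = ∫ p, 0 ∂ W z := by
      apply integral_congr_ae
      filter_upwards [start_ae hW z] with p hp
      rw [tau_zero (hp ▸ hz)]; simp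
    simp only [this]; simp
  · intro z hz
    have hc : ∀ w, (fun p => (tau A (consW z p) : ℝ)) =ᵐ[W w] fun p => (tau A p : ℝ) + 1 := by
      intro w
      filter_upwards [hit_ae hd hconn hreg hW A hA w] with p hp
      rw [tau_cons hz hp]; push_cast; ring
    have hi := fun w => tau_int hd hconn hreg hW A hA w
    beta_reduce
    rw [int_rec hd hreg hW z (fun p => (tau A p : ℝ)) (measurable_from_nat.comp (tau_meas A))
      (fun w => ((hi w).add (integrable_const 1)).congr (hc w).symm)]
    have e : ∀ w, ∫ p, (tau A (consW z p) : ℝ) ∂ W w = ∫ p, (tau A p : ℝ) ∂ W w + 1 := by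
      intro w
      rw [integral_congr_ae (hc w), integral_add (hi w) (integrable_const 1)]
      simp
    simp only [e, mul_add, mul_one, Finset.sum_add_distrib, tP_row hd hreg]
    ring

end walk
end GFF
namespace GFF

section field
variable {V : Type} [Fintype V]

lemma field_map {μ : Measure (V → ℝ)} {K : V → V → ℝ} (hμ : IsGaussianField μ K) (c : V → ℝ) :
    μ.map (fun ω => ∑ i, c i * ω i) =
      gaussianReal 0 (Real.toNNReal (∑ i, ∑ j, c i * c j * K i j)) := by
  have h := hμ.2 (Finsupp.equivFunOnFinite.symm c)
  have hs : ∀ i, i ∉ (Finsupp.equivFunOnFinite.symm c).support → c i = 0 := by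
    intro i hi
    simpa using hi
  have e1 : ∀ ω : V → ℝ, ∑ i ∈ (Finsupp.equivFunOnFinite.symm c).support,
      (Finsupp.equivFunOnFinite.symm c) i * ω i = ∑ i, c i * ω i := by
    intro ω
    apply Finset.sum_subset (Finset.subset_univ _)
    intro i _ hi
    simp [hs i hi]
  have e2 : ∑ i ∈ (Finsupp.equivFunOnFinite.symm c).support,
      ∑ j ∈ (Finsupp.equivFunOnFinite.symm c).support,
      (Finsupp.equivFunOnFinite.symm c) i * (Finsupp.equivFunOnFinite.symm c) j * K i j
      = ∑ i, ∑ j, c i * c j * K i j := by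
    have : ∀ i, ∑ j ∈ (Finsupp.equivFunOnFinite.symm c).support,
      (Finsupp.equivFunOnFinite.symm c) i * (Finsupp.equivFunOnFinite.symm c) j * K i j
      = ∑ j, c i * c j * K i j := by
      intro i
      apply Finset.sum_subset (Finset.subset_univ _)
      intro j _ hj
      simp [hs j hj]
    simp only [this]
    apply Finset.sum_subset (Finset.subset_univ _)
    intro j _ hj
    simp [hs j hj]
  rw [← e2, ← h]
  congr 1
  funext ω
  exact (e1 ω).symm

lemma field_gaussian {μ : Measure (V → ℝ)} {K : V → V → ℝ} (hμ : IsGaussianField μ K) :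
    IsGaussian μ := by
  constructor
  intro L
  have hL : ⇑L = fun ω => ∑ i, L (Pi.single i 1) * ω i := by
    funext ω
    have : ω = ∑ i, ω i • (Pi.single i (1:ℝ) : V → ℝ) := by
      ext j; simp [Pi.single_apply]
    conv_lhs => rw [this]
    simp only [map_sum, map_smul, smul_eq_mul, mul_comm]
  have hm := field_map hμ (fun i => L (Pi.single i 1))
  rw [← hL] at hm
  have hmeas : AEMeasurable (⇑L) μ := L.continuous.measurable.aemeasurable
  have h1 : μ[L] = 0 := by
    have := integral_map hmeas (f := fun x : ℝ => x) (by fun_prop)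
    rw [hm, integral_id_gaussianReal] at this
    exact this.symm
  have h2 : Var[L; μ] = (Real.toNNReal (∑ i, ∑ j, L (Pi.single i 1) * L (Pi.single j 1) * K i j)
      : ℝ≥0) := by
    rw [← variance_id_gaussianReal (μ := 0), ← hm, variance_map (by fun_prop) hmeas]
    rfl
  rw [h1, h2, hm, Real.toNNReal_coe]

lemma field_int {μ : Measure (V → ℝ)} {K : V → V → ℝ} (hμ : IsGaussianField μ K) (c : V → ℝ) :
    MemLp (fun ω : V → ℝ => ∑ i, c i * ω i) 2 μ ∧ μ[fun ω : V → ℝ => ∑ i, c i * ω i] = 0 := by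
  have hG := field_gaussian hμ
  have hmeas : AEMeasurable (fun ω : V → ℝ => ∑ i, c i * ω i) μ :=
    (Finset.measurable_fun_sum _ fun i _ => (measurable_pi_apply i).const_mul _).aemeasurable
  have hm := field_map hμ c
  have : IsGaussian (μ.map (fun ω : V → ℝ => ∑ i, c i * ω i)) := by rw [hm]; infer_instance
  have hl : HasGaussianLaw (fun ω : V → ℝ => ∑ i, c i * ω i) μ := IsGaussian.hasGaussianLaw
  refine ⟨hl.memLp_two, ?_⟩
  have := integral_map hmeas (f := fun x : ℝ => x) (by fun_prop)
  rw [hm, integral_id_gaussianReal] at this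
  exact this.symm

lemma field_var {μ : Measure (V → ℝ)} {K : V → V → ℝ} (hμ : IsGaussianField μ K)
    (hK : ∀ c : V → ℝ, 0 ≤ ∑ i, ∑ j, c i * c j * K i j) (c : V → ℝ) :
    Var[fun ω : V → ℝ => ∑ i, c i * ω i; μ] = ∑ i, ∑ j, c i * c j * K i j := by
  have hmeas : AEMeasurable (fun ω : V → ℝ => ∑ i, c i * ω i) μ :=
    (Finset.measurable_fun_sum _ fun i _ => (measurable_pi_apply i).const_mul _).aemeasurable
  have h2 : Var[fun ω : V → ℝ => ∑ i, c i * ω i; μ] =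
      (Real.toNNReal (∑ i, ∑ j, c i * c j * K i j) : ℝ≥0) := by
    rw [← variance_id_gaussianReal (μ := 0), ← field_map hμ c, variance_map (by fun_prop) hmeas]
    rfl
  rw [h2, Real.coe_toNNReal _ (hK c)]

lemma field_cov {μ : Measure (V → ℝ)} {K : V → V → ℝ} (hμ : IsGaussianField μ K)
    (hK : ∀ c : V → ℝ, 0 ≤ ∑ i, ∑ j, c i * c j * K i j) (hs : ∀ x y, K x y = K y x)
    (c : V → ℝ) (y : V) :
    cov[fun ω : V → ℝ => ∑ i, c i * ω i, fun ω => ω y; μ] = ∑ i, c i * K i y := by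
  have := hμ.1
  let e : V → ℝ := fun i => if i = y then 1 else 0
  have he : (fun ω : V → ℝ => ω y) = fun ω => ∑ i, e i * ω i := by
    funext ω; simp [e]
  have hsum : (fun ω : V → ℝ => ∑ i, c i * ω i) + (fun ω : V → ℝ => ∑ i, e i * ω i) =
      fun ω => ∑ i, (c i + e i) * ω i := by
    funext ω; simp [add_mul, Finset.sum_add_distrib]
  have h1 := variance_add (field_int hμ c).1 (field_int hμ e).1
  rw [hsum, field_var hμ hK, field_var hμ hK, field_var hμ hK] at h1
  rw [he]
  have h2 : ∑ i, ∑ j, (c i + e i) * (c j + e j) * K i j =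
      ∑ i, ∑ j, c i * c j * K i j + ∑ i, ∑ j, e i * e j * K i j
        + ∑ i, ∑ j, c i * e j * K i j + ∑ i, ∑ j, e i * c j * K i j := by
    simp only [← Finset.sum_add_distrib]
    apply Finset.sum_congr rfl; intro i _
    apply Finset.sum_congr rfl; intro j _
    ring
  have h3 : ∑ i, ∑ j, c i * e j * K i j = ∑ i, c i * K i y := by
    simp [e]
  have h4 : ∑ i, ∑ j, e i * c j * K i j = ∑ i, c i * K i y := by
    rw [Finset.sum_comm]
    simp [e, hs y]
  rw [h2, h3, h4] at h1
  linarith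

lemma field_condExp {μ : Measure (V → ℝ)} {K : V → V → ℝ} (hμ : IsGaussianField μ K)
    (hK : ∀ c : V → ℝ, 0 ≤ ∑ i, ∑ j, c i * c j * K i j) (hs : ∀ x y, K x y = K y x)
    (A : Set V) (x : V) (b : V → ℝ) (hb : ∀ a ∉ A, b a = 0)
    (hh : ∀ y ∈ A, K x y = ∑ a, b a * K a y) :
    μ[(fun ω => ω x) |
        MeasurableSpace.comap (fun ω : V → ℝ => A.restrict ω) inferInstance] =ᵐ[μ]
      fun ω => ∑ a, b a * ω a := by
  have := hμ.1
  have hG := field_gaussian hμ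
  let c : V → ℝ := fun i => (if i = x then 1 else 0) - b i
  have hc : ∀ f : V → ℝ, ∑ i, c i * f i = f x - ∑ i, b i * f i := by
    intro f; simp [c, sub_mul, Finset.sum_sub_distrib]
  let Z : (V → ℝ) → ℝ := fun ω => ∑ i, c i * ω i
  let L : (V → ℝ) →L[ℝ] ((Unit → ℝ) × (A → ℝ)) :=
    ContinuousLinearMap.prod
      (ContinuousLinearMap.pi fun _ => ∑ i, c i • ContinuousLinearMap.proj (R := ℝ) i)
      (ContinuousLinearMap.pi fun j : A => ContinuousLinearMap.proj (R := ℝ) (j : V))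
  have hlaw : HasGaussianLaw (fun ω : V → ℝ => ((fun _ : Unit => Z ω), (fun j : A => ω j))) μ := by
    have h := (IsGaussian.hasGaussianLaw_id (μ := μ)).map_fun L
    have e : (fun ω : V → ℝ => L (id ω)) =
        (fun ω : V → ℝ => ((fun _ : Unit => Z ω), (fun j : A => ω j))) := by
      funext ω
      apply Prod.ext
      · funext _
        simp [L, Z]
      · funext j
        simp [L]
    rw [e] at h
    exact h
  have hind := HasGaussianLaw.indepFun_of_covariance_eval (X := fun (_ : Unit) ω => Z ω)
    (Y := fun (j : A) (ω : V → ℝ) => ω j) hlaw (by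
      intro _ j
      rw [field_cov hμ hK hs, hc (fun i => K i j), hh j j.2]; ring)
  have hm1 : Measurable (fun (ω : V → ℝ) (_ : Unit) => Z ω) := by
    simp only [Z]; fun_prop
  have hm2 : Measurable (fun (ω : V → ℝ) => A.restrict ω) := by
    rw [measurable_pi_iff]; intro j; exact measurable_pi_apply _
  have hcz : μ[Z | MeasurableSpace.comap (fun ω : V → ℝ => A.restrict ω) inferInstance]
      =ᵐ[μ] fun _ => μ[Z] := by
    apply condExp_indep_eq hm1.comap_le hm2.comap_le _ hind
    apply Measurable.stronglyMeasurable
    exact (measurable_pi_apply ()).comp (comap_measurable (fun (ω : V → ℝ) (_ : Unit) => Z ω))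
  have hZ0 : μ[Z] = 0 := (field_int hμ c).2
  have hZi : Integrable Z μ := (field_int hμ c).1.integrable (by norm_num)
  have hBi : Integrable (fun ω : V → ℝ => ∑ a, b a * ω a) μ :=
    (field_int hμ b).1.integrable (by norm_num)
  have hBm : StronglyMeasurable[MeasurableSpace.comap (fun ω : V → ℝ => A.restrict ω)
      inferInstance] (fun ω : V → ℝ => ∑ a, b a * ω a) := by
    apply Measurable.stronglyMeasurable
    apply Finset.measurable_fun_sum
    intro a _
    by_cases ha : a ∈ A
    · apply Measurable.const_mul
      exact (measurable_pi_apply (⟨a, ha⟩ : A)).comp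
        (comap_measurable (fun ω : V → ℝ => A.restrict ω))
    · simp only [hb a ha, zero_mul]; exact measurable_const
  have hsplit : (fun ω : V → ℝ => ω x) = Z + fun ω => ∑ a, b a * ω a := by
    funext ω
    simp only [Pi.add_apply, Z, hc]; ring
  rw [hsplit]
  have hadd := condExp_add (m := MeasurableSpace.comap (fun ω : V → ℝ => A.restrict ω)
      inferInstance) hZi hBi
  have hB := condExp_of_stronglyMeasurable hm2.comap_le hBm hBi
  filter_upwards [hadd, hcz] with ω h1 h2
  rw [h1, Pi.add_apply, h2, hB, hZ0, zero_add]

end field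
end GFF

/-- conditional expectation of the zero-average GFF given its values on
`A`. -/
theorem gff_conditional_expectation
    (d : ℕ) (hd : 3 ≤ d)
    (V : Type) [Fintype V] [MeasurableSpace V]
    (G : SimpleGraph V) (hconn : G.Connected) (hreg : GFF.IsReg G d)
    (μ : Measure (V → ℝ)) (hμ : GFF.IsGaussianField μ (GFF.zGreen G d (Fintype.card V)))
    (W : V → Measure (ℕ → V)) (hW : GFF.IsSRW G d W)
    (A : Set V) (hA : A.Nonempty) (hAne : A ≠ Set.univ) (x : V) :
    μ[(fun ω => ω x) |
        MeasurableSpace.comap (fun ω : V → ℝ => A.restrict ω) inferInstance] =ᵐ[μ]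
      fun ω =>
        (∫ p, ω (GFF.stopAt A p) ∂ W x) -
          ((∫ p, ((GFF.hitTime A p).toNat : ℝ) ∂ W x) /
              ((Fintype.card V : ℝ)⁻¹ *
                ∑ z : V, ∫ p, ((GFF.hitTime A p).toNat : ℝ) ∂ W z)) *
            ((Fintype.card V : ℝ)⁻¹ * ∑ z : V, ∫ p, ω (GFF.stopAt A p) ∂ W z) := by
  have hVne : Nonempty V := ⟨x⟩
  have hN : (Fintype.card V : ℝ) ≠ 0 := by positivity
  obtain ⟨h, T, h1, h2, h3, h4, h5, hT0, hTA, hTn⟩ := GFF.walk_facts hd hconn hreg hW A hA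
  have hTpos : 0 < ∑ z, T z := by
    obtain ⟨z, hz⟩ := (Set.ne_univ_iff_exists_notMem A).mp hAne
    have hz1 : 0 < T z := by
      rw [hTn z hz]
      have := Finset.sum_nonneg (s := Finset.univ)
        (fun w _ => mul_nonneg (GFF.tP_nonneg (G := G) (d := d) z w) (hT0 w))
      linarith
    exact hz1.trans_le (Finset.single_le_sum (f := T) (fun w _ => hT0 w) (Finset.mem_univ z))
  simp only [h1, h2]
  set N : ℝ := (Fintype.card V : ℝ) with hNdef
  set K := GFF.zGreen G d (Fintype.card V) with hK
  set r : ℝ := T x / (N⁻¹ * ∑ z, T z) with hr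
  have hcond := GFF.field_condExp hμ (GFF.zGreen_psd hd hconn hreg)
    (fun x y => GFF.zGreen_symm x y _) A x
    (fun a => h x a - r * (N⁻¹ * ∑ z, h z a))
    (fun a ha => by simp [h3 _ a ha])
    (by
      intro y hy
      obtain ⟨hs, hg⟩ := GFF.zGreen_eq hd hconn hreg y
      have key : ∀ z, K z y = ∑ a, h z a * K a y - T z / N := by
        intro z
        have := GFF.dirichlet_unique hd hconn hreg A hA
          (fun z => K z y - ∑ a, h z a * K a y + T z / N)
          (by intro z hz; simp only [h4 z hz (fun a => K a y), hTA z hz]; simp)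
          (by
            intro z hz
            have e1 := hg z
            have hzy : z ≠ y := fun e => hz (e ▸ hy)
            rw [if_neg hzy] at e1
            have e2 := h5 z hz (fun a => K a y)
            have e3 := hTn z hz
            simp only [mul_add, mul_sub, Finset.sum_add_distrib, Finset.sum_sub_distrib]
            have e4 : ∑ w, GFF.transP G d z w * (T w / N) = (T z - 1) / N := by
              rw [e3, add_sub_cancel_left, Finset.sum_div]
              apply Finset.sum_congr rfl; intros; ring
            rw [e4, ← e2, sub_div]
            linarith) z
        linarith
      have hmean : ∑ z, ∑ a, h z a * K a y = (∑ z, T z) / N := by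
        have e : ∑ z, K z y = ∑ z, (∑ a, h z a * K a y - T z / N) :=
          Finset.sum_congr rfl fun z _ => key z
        rw [hs, Finset.sum_sub_distrib, ← Finset.sum_div] at e
        linarith
      have e5 : ∑ a, (h x a - r * (N⁻¹ * ∑ z, h z a)) * K a y =
          ∑ a, h x a * K a y - r * (N⁻¹ * ∑ z, ∑ a, h z a * K a y) := by
        rw [Finset.sum_comm (f := fun z a => h z a * K a y)]
        simp only [sub_mul, Finset.sum_sub_distrib, Finset.mul_sum, Finset.sum_mul]
        congr 1
        apply Finset.sum_congr rfl; intro u _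
        apply Finset.sum_congr rfl; intro v _
        ring
      rw [e5, key x, hmean, hr]
      have := hTpos.ne'
      field_simp)
  refine hcond.trans (Eventually.of_forall fun ω => ?_)
  beta_reduce
  rw [Finset.sum_comm (f := fun z a => h z a * ω a)]
  simp only [sub_mul, Finset.sum_sub_distrib, Finset.mul_sum, Finset.sum_mul]
  congr 1
  apply Finset.sum_congr rfl; intro u _
  apply Finset.sum_congr rfl; intro v _
  ring
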